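/- arXiv:1701.05816 — 4 statements merged into one kernel-verified Lean document; each statement's English description precedes it below -/
import Mathlib

section
/- Let U ⊆ ℝ be open and let f₁, f₂ : U → U be real-analytic maps with a common non-hyperbolic fixed point p ∈ U (i.e. |f₁'(p)| = |f₂'(p)| = 1) which is locally asymptotically stable (LAS) for both maps. If at least one of the maps preserves orientation at p (i.e. f₁'(p) = 1 or f₂'(p) = 1), then p is LAS for the composition map f₂ ∘ f₁. Similarly, if p is a repeller for both maps and at least one of them preserves orientation at p, then p is a repeller for f₂ ∘ f₁. -/
open Filter Topology

/-- `p` is a locally asymptotically stable (LAS) fixed point of `f`. -/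
def IsLAS (f : ℝ → ℝ) (p : ℝ) : Prop :=
  (∀ ε > 0, ∃ δ > 0, ∀ x : ℝ, |x - p| < δ → ∀ n : ℕ, 1 ≤ n → |f^[n] x - p| < ε) ∧
  (∃ η > 0, ∀ x : ℝ, |x - p| < η → Tendsto (fun n => f^[n] x) atTop (𝓝 p))

/-- `p` is a repeller fixed point of `f`. -/
def IsRepeller (f : ℝ → ℝ) (p : ℝ) : Prop :=
  ∃ ε₀ > 0, ∀ ε : ℝ, 0 < ε → ε < ε₀ → ∀ x : ℝ, x ≠ p → |x - p| < ε →
    ∃ n : ℕ, |f^[n] x - p| > ε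

/-- `p` is semi-asymptotically stable from the left for `f`. -/
def IsSemiASLeft (f : ℝ → ℝ) (p : ℝ) : Prop :=
  (∀ ε > 0, ∃ δ > 0, ∀ x ∈ Set.Ioo (p - δ) p, ∀ n : ℕ, 1 ≤ n → |f^[n] x - p| < ε) ∧
  (∃ η > 0, ∀ x ∈ Set.Ioo (p - η) p, Tendsto (fun n => f^[n] x) atTop (𝓝 p)) ∧
  (∃ η > 0, ∀ x ∈ Set.Ioo p (p + η), ∃ n : ℕ, |f^[n] x - p| > η)

/-- `p` is semi-asymptotically stable from the right for `f`. -/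
def IsSemiASRight (f : ℝ → ℝ) (p : ℝ) : Prop :=
  (∀ ε > 0, ∃ δ > 0, ∀ x ∈ Set.Ioo p (p + δ), ∀ n : ℕ, 1 ≤ n → |f^[n] x - p| < ε) ∧
  (∃ η > 0, ∀ x ∈ Set.Ioo p (p + η), Tendsto (fun n => f^[n] x) atTop (𝓝 p)) ∧
  (∃ η > 0, ∀ x ∈ Set.Ioo (p - η) p, ∃ n : ℕ, |f^[n] x - p| > η)

/-- `p` is semi-asymptotically stable (from the left or from the right) for `f`. -/
def IsSemiAS (f : ℝ → ℝ) (p : ℝ) : Prop := IsSemiASLeft f p ∨ IsSemiASRight f p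

section LocalDynamics

variable {f g a b : ℝ → ℝ} {p : ℝ}

theorem iterate_comp_self (f : ℝ → ℝ) (n : ℕ) : (f ∘ f)^[n] = f^[2 * n] :=
  (Function.iterate_mul f 2 n).symm

theorem IsLAS.comp_self (h : IsLAS f p) : IsLAS (f ∘ f) p := by
  obtain ⟨hs, η, hη, ht⟩ := h
  refine ⟨fun ε hε => ?_, η, hη, fun x hx => ?_⟩
  · obtain ⟨δ, hδ, H⟩ := hs ε hε
    refine ⟨δ, hδ, fun x hx n hn => ?_⟩
    rw [iterate_comp_self]
    exact H x hx _ (by omega)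
  · simp only [iterate_comp_self]
    exact (ht x hx).comp (tendsto_id.const_mul_atTop' two_pos)

theorem IsLAS.of_comp_self (hf : ContinuousAt f p) (hp : f p = p) (h : IsLAS (f ∘ f) p) :
    IsLAS f p := by
  obtain ⟨hs, η, hη, ht⟩ := h
  have iterate_odd (x : ℝ) (n : ℕ) : f^[2 * n + 1] x = f ((f ∘ f)^[n] x) := by
    rw [iterate_comp_self, Function.iterate_succ_apply']
  refine ⟨fun ε hε => ?_, η, hη, fun x hx => ?_⟩
  · obtain ⟨r, hr, hfr⟩ := Metric.continuousAt_iff.1 hf ε hε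
    simp only [Real.dist_eq, hp] at hfr
    obtain ⟨δ, hδ, H⟩ := hs (min ε r) (lt_min hε hr)
    refine ⟨min δ r, lt_min hδ hr, fun x hx n hn => ?_⟩
    obtain ⟨k, rfl | rfl⟩ := n.even_or_odd'
    · rw [← iterate_comp_self]
      exact (H x (hx.trans_le (min_le_left _ _)) k (by omega)).trans_le (min_le_left _ _)
    · rw [iterate_odd]
      apply hfr
      rcases k.eq_zero_or_pos with rfl | hk
      · exact hx.trans_le (min_le_right _ _)
      · exact (H x (hx.trans_le (min_le_left _ _)) k hk).trans_le (min_le_right _ _)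
  · have heven := ht x hx
    have hodd : Tendsto (fun n => f ((f ∘ f)^[n] x)) atTop (𝓝 p) := by
      have := hf.tendsto.comp heven
      rwa [hp] at this
    rw [Metric.tendsto_atTop] at heven hodd ⊢
    intro ε hε
    obtain ⟨N, hN⟩ := heven ε hε
    obtain ⟨M, hM⟩ := hodd ε hε
    refine ⟨2 * (N + M), fun n hn => ?_⟩
    obtain ⟨k, rfl | rfl⟩ := n.even_or_odd'
    · rw [← iterate_comp_self]
      exact hN k (by omega)
    · rw [iterate_odd]
      exact hM k (by omega)

theorem IsRepeller.comp_self (hf : ContinuousAt f p) (hp : f p = p) (h : IsRepeller f p) :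
    IsRepeller (f ∘ f) p := by
  obtain ⟨ε₀, hε₀, H⟩ := h
  obtain ⟨r, hr, hfr⟩ := Metric.continuousAt_iff.1 hf (ε₀ / 2) (by positivity)
  simp only [Real.dist_eq, hp] at hfr
  refine ⟨min ε₀ r, lt_min hε₀ hr, fun ε hε hlt x hxp hx => ?_⟩
  by_contra! hcon
  obtain ⟨n, hn⟩ := H (max ε (ε₀ / 2)) (lt_max_of_lt_left hε)
    (max_lt (hlt.trans_le (min_le_left _ _)) (by linarith)) x hxp (lt_max_of_lt_left hx)
  obtain ⟨k, rfl | rfl⟩ := n.even_or_odd'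
  · rw [← iterate_comp_self] at hn
    exact (((hcon k).trans (le_max_left _ _)).trans_lt hn).false
  · rw [Function.iterate_succ_apply', ← iterate_comp_self] at hn
    have := hfr ((hcon k).trans_lt (hlt.trans_le (min_le_right _ _)))
    exact ((this.le.trans (le_max_right _ _)).trans_lt hn).false

theorem IsRepeller.of_comp_self (h : IsRepeller (f ∘ f) p) : IsRepeller f p := by
  obtain ⟨ε₀, hε₀, H⟩ := h
  refine ⟨ε₀, hε₀, fun ε hε hlt x hxp hx => ?_⟩
  obtain ⟨n, hn⟩ := H ε hε hlt x hxp hx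
  exact ⟨2 * n, by rwa [iterate_comp_self] at hn⟩

/-- A continuous positive function on a closed annulus around `p` is bounded below by a positive
constant. -/
theorem exists_pos_forall_annulus_le {φ : ℝ → ℝ} {r s : ℝ}
    (hφ : ∀ x, r ≤ |x - p| → |x - p| ≤ s → ContinuousAt φ x ∧ 0 < φ x) :
    ∃ m > 0, ∀ x, r ≤ |x - p| → |x - p| ≤ s → m ≤ φ x := by
  have hK : IsCompact {x : ℝ | r ≤ |x - p| ∧ |x - p| ≤ s} := by
    refine (isCompact_closedBall p s).of_isClosed_subset ?_ fun x hx => ?_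
    · exact (isClosed_le (g := fun x => |x - p|) continuous_const (by fun_prop)).inter
        (isClosed_le (f := fun x => |x - p|) (by fun_prop) continuous_const)
    · simpa [Real.dist_eq] using hx.2
  rcases Set.eq_empty_or_nonempty {x : ℝ | r ≤ |x - p| ∧ |x - p| ≤ s} with he | hne
  · exact ⟨1, one_pos, fun x h₁ h₂ => (Set.eq_empty_iff_forall_notMem.1 he x ⟨h₁, h₂⟩).elim⟩
  · obtain ⟨y, hy, hmin⟩ := hK.exists_isMinOn hne
      fun x hx => (hφ x hx.1 hx.2).1.continuousWithinAt
    exact ⟨φ y, (hφ y hy.1 hy.2).2, fun x h₁ h₂ => hmin ⟨h₁, h₂⟩⟩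

theorem isLAS_of_eventually_abs_lt (hc : ∀ᶠ x in 𝓝 p, ContinuousAt g x) (hp : g p = p)
    (h : ∀ᶠ x in 𝓝[≠] p, |g x - p| < |x - p|) : IsLAS g p := by
  obtain ⟨r, hr, H⟩ := Metric.eventually_nhds_iff.1 (hc.and (eventually_nhdsWithin_iff.1 h))
  simp only [Real.dist_eq] at H
  have step {x : ℝ} (hx : |x - p| < r) : |g x - p| ≤ |x - p| := by
    by_cases hxp : x = p
    · simp [hxp, hp]
    · exact ((H hx).2 hxp).le
  have bound {x : ℝ} (hx : |x - p| < r) (n : ℕ) : |g^[n] x - p| ≤ |x - p| := by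
    induction n with
    | zero => rfl
    | succ n ih =>
      rw [Function.iterate_succ_apply']
      exact (step (ih.trans_lt hx)).trans ih
  refine ⟨fun ε hε => ⟨min ε r, lt_min hε hr, fun x hx n _ => ?_⟩, r, hr, fun x hx => ?_⟩
  · exact (bound (hx.trans_le (min_le_right _ _)) n).trans_lt (hx.trans_le (min_le_left _ _))
  · have anti {m n : ℕ} (hmn : m ≤ n) : |g^[n] x - p| ≤ |g^[m] x - p| := by
      obtain ⟨k, rfl⟩ := Nat.exists_eq_add_of_le' hmn
      rw [Function.iterate_add_apply]
      exact bound ((bound hx m).trans_lt hx) k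
    rw [Metric.tendsto_atTop]
    intro ε hε
    simp only [Real.dist_eq]
    suffices ∃ N, |g^[N] x - p| < ε from
      this.imp fun N hN n hn => (anti hn).trans_lt hN
    by_contra! hcon
    obtain ⟨m, hm, hmle⟩ := exists_pos_forall_annulus_le (p := p) (r := ε) (s := |x - p|)
      (φ := fun y => |y - p| - |g y - p|) fun y h₁ h₂ => by
        have hy := H (h₂.trans_lt hx)
        have := hy.1
        refine ⟨by fun_prop, sub_pos.2 (hy.2 fun hyp => ?_)⟩
        simp only [Set.mem_singleton_iff] at hyp
        simp only [hyp, sub_self, abs_zero] at h₁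
        linarith
    have decay (n : ℕ) : |g^[n] x - p| ≤ |x - p| - n * m := by
      induction n with
      | zero => simp
      | succ n ih =>
        have := hmle _ (hcon n) (bound hx n)
        rw [Function.iterate_succ_apply']
        push_cast
        linarith
    obtain ⟨n, hn⟩ := exists_nat_gt (|x - p| / m)
    rw [div_lt_iff₀ hm] at hn
    linarith [decay n, abs_nonneg (g^[n] x - p)]

theorem isRepeller_of_eventually_lt_abs (hc : ∀ᶠ x in 𝓝 p, ContinuousAt g x)
    (h : ∀ᶠ x in 𝓝[≠] p, |x - p| < |g x - p|) : IsRepeller g p := by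
  obtain ⟨r, hr, H⟩ := Metric.eventually_nhds_iff.1 (hc.and (eventually_nhdsWithin_iff.1 h))
  simp only [Real.dist_eq] at H
  refine ⟨r, hr, fun ε hε hlt x hxp hx => ?_⟩
  by_contra! hcon
  have hx0 : 0 < |x - p| := abs_pos.2 (sub_ne_zero.2 hxp)
  obtain ⟨m, hm, hmle⟩ := exists_pos_forall_annulus_le (p := p) (r := |x - p|) (s := ε)
    (φ := fun y => |g y - p| - |y - p|) fun y h₁ h₂ => by
      have hy := H (h₂.trans_lt hlt)
      have := hy.1
      refine ⟨by fun_prop, sub_pos.2 (hy.2 fun hyp => ?_)⟩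
      simp only [Set.mem_singleton_iff] at hyp
      simp only [hyp, sub_self, abs_zero] at h₁
      linarith
  have growth (n : ℕ) : |x - p| + n * m ≤ |g^[n] x - p| := by
    induction n with
    | zero => simp
    | succ n ih =>
      have := hmle _ (by nlinarith [n.cast_nonneg (α := ℝ)]) (hcon n)
      rw [Function.iterate_succ_apply']
      push_cast
      linarith
  obtain ⟨n, hn⟩ := exists_nat_gt (ε / m)
  rw [div_lt_iff₀ hm] at hn
  linarith [growth n, hcon n]

theorem forall_abs_lt_or_forall_lt_abs {I : Set ℝ} (hI : IsPreconnected I)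
    (hg : ∀ x ∈ I, ContinuousAt g x) (hne : ∀ x ∈ I, |g x - p| ≠ |x - p|) :
    (∀ x ∈ I, |g x - p| < |x - p|) ∨ ∀ x ∈ I, |x - p| < |g x - p| := by
  by_contra! ⟨⟨x, hx, hxle⟩, y, hy, hyle⟩
  obtain ⟨z, hz, hze⟩ := hI.intermediate_value₂ hy hx
    (f := fun x => |g x - p|) (g := fun x => |x - p|)
    (fun x hx => by have := hg x hx; exact ContinuousAt.continuousWithinAt (by fun_prop))
    (by fun_prop) hyle hxle
  exact hne z hz hze

theorem IsLAS.forall_abs_lt {I : Set ℝ} {r : ℝ} (hI : IsPreconnected I)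
    (hg : ∀ x ∈ I, ContinuousAt g x) (hne : ∀ x ∈ I, |g x - p| ≠ |x - p|)
    (hpI : p ∈ closure I) (hp : p ∉ I) (hr : 0 < r) (hmaps : ∀ x ∈ I, |g x - p| < r → g x ∈ I)
    (h : IsLAS g p) : ∀ x ∈ I, |g x - p| < |x - p| := by
  refine (forall_abs_lt_or_forall_lt_abs hI hg hne).resolve_right fun hgt => ?_
  obtain ⟨hs, η, hη, ht⟩ := h
  obtain ⟨δ, hδ, H⟩ := hs r hr
  obtain ⟨x, hxI, hx⟩ := Metric.mem_closure_iff.1 hpI (min δ η) (lt_min hδ hη)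
  rw [dist_comm, Real.dist_eq] at hx
  have mem (n : ℕ) : g^[n] x ∈ I ∧ |x - p| ≤ |g^[n] x - p| := by
    induction n with
    | zero => exact ⟨hxI, le_rfl⟩
    | succ n ih =>
      have := H x (hx.trans_le (min_le_left _ _)) (n + 1) (by omega)
      rw [Function.iterate_succ_apply'] at this ⊢
      exact ⟨hmaps _ ih.1 this, ih.2.trans (hgt _ ih.1).le⟩
  have hlim : Tendsto (fun n => |g^[n] x - p|) atTop (𝓝 |p - p|) :=
    ((ht x (hx.trans_le (min_le_right _ _))).sub_const p).abs
  have hle := ge_of_tendsto' hlim fun n => (mem n).2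
  have hxp : x = p := by simpa [sub_eq_zero] using hle
  exact hp (hxp ▸ hxI)

theorem IsRepeller.forall_lt_abs {I : Set ℝ} {r : ℝ} (hI : IsPreconnected I)
    (hg : ∀ x ∈ I, ContinuousAt g x) (hne : ∀ x ∈ I, |g x - p| ≠ |x - p|)
    (hpI : p ∈ closure I) (hp : p ∉ I) (hr : 0 < r) (hmaps : ∀ x ∈ I, |g x - p| < r → g x ∈ I)
    (h : IsRepeller g p) : ∀ x ∈ I, |x - p| < |g x - p| := by
  refine (forall_abs_lt_or_forall_lt_abs hI hg hne).resolve_left fun hlt => ?_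
  obtain ⟨ε₀, hε₀, H⟩ := h
  obtain ⟨x, hxI, hx⟩ := Metric.mem_closure_iff.1 hpI (min (ε₀ / 2) r)
    (lt_min (by positivity) hr)
  rw [dist_comm, Real.dist_eq] at hx
  have mem (n : ℕ) : g^[n] x ∈ I ∧ |g^[n] x - p| ≤ |x - p| := by
    induction n with
    | zero => exact ⟨hxI, le_rfl⟩
    | succ n ih =>
      rw [Function.iterate_succ_apply']
      have := (hlt _ ih.1).le.trans ih.2
      exact ⟨hmaps _ ih.1 (this.trans_lt (hx.trans_le (min_le_right _ _))), this⟩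
  have hx' := hx.trans_le (min_le_left _ _)
  obtain ⟨n, hn⟩ := H (ε₀ / 2) (by positivity) (by linarith) x (fun h => hp (h ▸ hxI)) hx'
  linarith [(mem n).2]

/-- The sides of `p` are preserved near `p`. -/
def PreservesSides (g : ℝ → ℝ) (p : ℝ) : Prop :=
  ∀ᶠ x in 𝓝 p, (p < x → p < g x) ∧ (x < p → g x < p)

/-- One-sided neighbourhoods suffice to establish a property near `p`. -/
theorem PreservesSides.eventually_of_intervals (hs : PreservesSides g p)
    (hc : ∀ᶠ x in 𝓝 p, ContinuousAt g x) (hfix : ∀ᶠ x in 𝓝[≠] p, g x ≠ x) {P : ℝ → Prop}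
    (hP : ∀ (I : Set ℝ) (r : ℝ), IsPreconnected I → (∀ x ∈ I, ContinuousAt g x) →
      (∀ x ∈ I, |g x - p| ≠ |x - p|) → p ∈ closure I → p ∉ I → 0 < r →
      (∀ x ∈ I, |g x - p| < r → g x ∈ I) → ∀ x ∈ I, P x) :
    ∀ᶠ x in 𝓝[≠] p, P x := by
  obtain ⟨r, hr, H⟩ := Metric.eventually_nhds_iff.1
    (hs.and (hc.and (eventually_nhdsWithin_iff.1 hfix)))
  simp only [Real.dist_eq] at H
  have hright : ∀ x ∈ Set.Ioo p (p + r), P x := by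
    have near {x : ℝ} (hx : x ∈ Set.Ioo p (p + r)) :=
      H (y := x) (by rw [abs_lt]; constructor <;> linarith [hx.1, hx.2])
    refine hP _ r isPreconnected_Ioo (fun x hx => (near hx).2.1) (fun x hx heq => ?_) ?_
      (by simp) hr fun x hx hlt => ⟨(near hx).1.1 hx.1, by linarith [(abs_lt.1 hlt).2]⟩
    · rw [abs_of_pos (sub_pos.2 ((near hx).1.1 hx.1)), abs_of_pos (sub_pos.2 hx.1)] at heq
      exact (near hx).2.2 hx.1.ne' (by linarith)
    · rw [closure_Ioo (by linarith)]
      exact ⟨le_rfl, by linarith⟩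
  have hleft : ∀ x ∈ Set.Ioo (p - r) p, P x := by
    have near {x : ℝ} (hx : x ∈ Set.Ioo (p - r) p) :=
      H (y := x) (by rw [abs_lt]; constructor <;> linarith [hx.1, hx.2])
    refine hP _ r isPreconnected_Ioo (fun x hx => (near hx).2.1) (fun x hx heq => ?_) ?_
      (by simp) hr fun x hx hlt => ⟨by linarith [(abs_lt.1 hlt).1], (near hx).1.2 hx.2⟩
    · rw [abs_of_neg (sub_neg.2 ((near hx).1.2 hx.2)), abs_of_neg (sub_neg.2 hx.2)] at heq
      exact (near hx).2.2 hx.2.ne (by linarith)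
    · rw [closure_Ioo (by linarith)]
      exact ⟨by linarith, le_rfl⟩
  rw [eventually_nhdsWithin_iff]
  filter_upwards [Ioo_mem_nhds (sub_lt_self p hr) (lt_add_of_pos_right p hr)] with x hx hxp
  rcases lt_or_gt_of_ne hxp with h | h
  · exact hleft x ⟨hx.1, h⟩
  · exact hright x ⟨h, hx.2⟩

theorem IsLAS.eventually_abs_lt (h : IsLAS g p) (hs : PreservesSides g p)
    (hc : ∀ᶠ x in 𝓝 p, ContinuousAt g x) : ∀ᶠ x in 𝓝[≠] p, |g x - p| < |x - p| := by
  refine hs.eventually_of_intervals hc ?_ fun I r hI hg hne hpI hp hr hmaps =>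
    h.forall_abs_lt hI hg hne hpI hp hr hmaps
  obtain ⟨η, hη, ht⟩ := h.2
  rw [eventually_nhdsWithin_iff]
  filter_upwards [Metric.ball_mem_nhds p hη] with x hx hxp heq
  have hlim := ht x hx
  simp only [Function.iterate_fixed heq] at hlim
  exact hxp (tendsto_nhds_unique tendsto_const_nhds hlim)

theorem IsRepeller.eventually_lt_abs (h : IsRepeller g p) (hs : PreservesSides g p)
    (hc : ∀ᶠ x in 𝓝 p, ContinuousAt g x) : ∀ᶠ x in 𝓝[≠] p, |x - p| < |g x - p| := by
  refine hs.eventually_of_intervals hc ?_ fun I r hI hg hne hpI hp hr hmaps =>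
    h.forall_lt_abs hI hg hne hpI hp hr hmaps
  obtain ⟨ε₀, hε₀, H⟩ := h
  rw [eventually_nhdsWithin_iff]
  filter_upwards [Metric.ball_mem_nhds p (half_pos hε₀)] with x hx hxp heq
  have hx : |x - p| < ε₀ / 2 := hx
  obtain ⟨n, hn⟩ := H (ε₀ / 2) (half_pos hε₀) (by linarith) x hxp hx
  rw [Function.iterate_fixed heq] at hn
  exact hn.not_gt hx

theorem HasStrictDerivAt.eventually_abs_sub_le {d : ℝ} (h : HasStrictDerivAt f d p) :
    ∀ᶠ x : ℝ × ℝ in 𝓝 (p, p), |f x.1 - f x.2 - d * (x.1 - x.2)| ≤ 1 / 2 * |x.1 - x.2| := by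
  have := h.hasStrictFDerivAt.isLittleO.bound (c := 1 / 2) (by norm_num)
  simpa [mul_comm] using this

theorem preservesSides_of_hasStrictDerivAt (h : HasStrictDerivAt g 1 p) (hp : g p = p) :
    PreservesSides g p := by
  have hx : Tendsto (fun x : ℝ => (x, p)) (𝓝 p) (𝓝 (p, p)) :=
    Continuous.tendsto (by fun_prop) p
  filter_upwards [hx.eventually h.eventually_abs_sub_le] with x hx
  simp only [hp] at hx
  rw [abs_le] at hx
  constructor <;> intro hlt
  · rw [abs_of_pos (sub_pos.2 hlt)] at hx
    linarith
  · rw [abs_of_neg (sub_neg.2 hlt)] at hx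
    linarith

/-- A map with multiplier `±1` is locally monotone with respect to the distance from `p`. -/
theorem exists_forall_abs_lt_abs {d : ℝ} (h : HasStrictDerivAt b d p) (hd : |d| = 1)
    (hp : b p = p) : ∃ δ > 0, ∀ u v, |v - p| < δ → (p < u ∧ u < v) ∨ (v < u ∧ u < p) →
      |b u - p| < |b v - p| := by
  obtain ⟨δ, hδ, H⟩ := Metric.eventually_nhds_iff.1 h.eventually_abs_sub_le
  have H' {x y : ℝ} (hx : |x - p| < δ) (hy : |y - p| < δ) :=
    abs_le.1 (H (y := (x, y)) (max_lt hx hy))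
  refine ⟨δ, hδ, fun u v hv huv => ?_⟩
  have hv' := abs_lt.1 hv
  have hu : |u - p| < δ := by
    rw [abs_lt]
    rcases huv with h | h <;> constructor <;> linarith [h.1, h.2]
  have hup := H' hu (y := p) (by simpa using hδ)
  have hvu := H' hv hu
  simp only [hp] at hup
  have hd' : d = 1 ∨ d = -1 := eq_or_eq_neg_of_abs_eq hd
  rcases huv with ⟨h₁, h₂⟩ | ⟨h₁, h₂⟩
  · rw [abs_of_pos (sub_pos.2 h₁)] at hup
    rw [abs_of_pos (sub_pos.2 h₂)] at hvu
    rcases hd' with rfl | rfl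
    · rw [abs_of_pos (by linarith), abs_of_pos (by linarith)]
      linarith
    · rw [abs_of_neg (by linarith), abs_of_neg (by linarith)]
      linarith
  · rw [abs_of_neg (sub_neg.2 h₂)] at hup
    rw [abs_of_neg (sub_neg.2 h₁)] at hvu
    rcases hd' with rfl | rfl
    · rw [abs_of_neg (by linarith), abs_of_neg (by linarith)]
      linarith
    · rw [abs_of_pos (by linarith), abs_of_pos (by linarith)]
      linarith

theorem AnalyticAt.eventually_continuousAt_nhds (h : AnalyticAt ℝ f p) :
    ∀ᶠ x in 𝓝 p, ContinuousAt f x :=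
  h.eventually_analyticAt.mono fun _ hx => hx.continuousAt

theorem tendsto_punctured_of_abs_deriv_eq_one (hb : AnalyticAt ℝ b p) (hp : b p = p)
    (hd : |deriv b p| = 1) : Tendsto b (𝓝[≠] p) (𝓝[≠] p) := by
  have := hb.differentiableAt.hasDerivAt.tendsto_nhdsNE
    (fun h => by simp [h] at hd)
  rwa [hp] at this

theorem preservesSides_of_deriv_eq_one (ha : AnalyticAt ℝ a p) (hp : a p = p)
    (hd : deriv a p = 1) : PreservesSides a p :=
  preservesSides_of_hasStrictDerivAt (hd ▸ ha.hasStrictDerivAt) hp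

theorem preservesSides_comp_self (hb : AnalyticAt ℝ b p) (hp : b p = p)
    (hd : |deriv b p| = 1) : PreservesSides (b ∘ b) p := by
  have hb' : HasStrictDerivAt b (deriv b p) p := hb.hasStrictDerivAt
  have h := HasStrictDerivAt.comp p (h₂ := b) (by rwa [hp]) hb'
  rw [← sq, ← sq_abs, hd, one_pow] at h
  exact preservesSides_of_hasStrictDerivAt h (by simp [hp])

theorem analyticAt_comp_of_fixed (hb : AnalyticAt ℝ b p) (ha : AnalyticAt ℝ a p)
    (hp : a p = p) : AnalyticAt ℝ (b ∘ a) p :=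
  AnalyticAt.comp (by rwa [hp]) ha

theorem IsLAS.eventually_abs_sandwich_lt
    (ha : AnalyticAt ℝ a p) (hap : a p = p) (had : deriv a p = 1)
    (hb : AnalyticAt ℝ b p) (hbp : b p = p) (hbd : |deriv b p| = 1)
    (hA : IsLAS a p) (hB : IsLAS b p) :
    ∀ᶠ x in 𝓝[≠] p, |b (a (b x)) - p| < |x - p| := by
  have hBB := hB.comp_self.eventually_abs_lt (preservesSides_comp_self hb hbp hbd)
    (analyticAt_comp_of_fixed hb hb hbp).eventually_continuousAt_nhds
  have hs := preservesSides_of_deriv_eq_one ha hap had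
  have hAA := hA.eventually_abs_lt hs ha.eventually_continuousAt_nhds
  obtain ⟨δ, hδ, H⟩ := exists_forall_abs_lt_abs hb.hasStrictDerivAt hbd hbp
  have hba : ∀ᶠ y in 𝓝[≠] p, |b (a y) - p| < |b y - p| := by
    filter_upwards [hAA, hs.filter_mono nhdsWithin_le_nhds,
      nhdsWithin_le_nhds (Metric.ball_mem_nhds p hδ), self_mem_nhdsWithin] with y hy hsy hyδ hyp
    refine H _ _ hyδ ?_
    rcases lt_or_gt_of_ne hyp with h | h
    · have := hsy.2 h
      rw [abs_of_neg (sub_neg.2 this), abs_of_neg (sub_neg.2 h)] at hy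
      exact Or.inr ⟨by linarith, this⟩
    · have := hsy.1 h
      rw [abs_of_pos (sub_pos.2 this), abs_of_pos (sub_pos.2 h)] at hy
      exact Or.inl ⟨this, by linarith⟩
  filter_upwards [hBB, (tendsto_punctured_of_abs_deriv_eq_one hb hbp hbd).eventually hba]
    with x h₁ h₂ using h₂.trans h₁

theorem IsRepeller.eventually_lt_abs_sandwich
    (ha : AnalyticAt ℝ a p) (hap : a p = p) (had : deriv a p = 1)
    (hb : AnalyticAt ℝ b p) (hbp : b p = p) (hbd : |deriv b p| = 1)
    (hA : IsRepeller a p) (hB : IsRepeller b p) :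
    ∀ᶠ x in 𝓝[≠] p, |x - p| < |b (a (b x)) - p| := by
  have hBB := (hB.comp_self hb.continuousAt hbp).eventually_lt_abs
    (preservesSides_comp_self hb hbp hbd)
    (analyticAt_comp_of_fixed hb hb hbp).eventually_continuousAt_nhds
  have hs := preservesSides_of_deriv_eq_one ha hap had
  have hAA := hA.eventually_lt_abs hs ha.eventually_continuousAt_nhds
  obtain ⟨δ, hδ, H⟩ := exists_forall_abs_lt_abs hb.hasStrictDerivAt hbd hbp
  have hball : ∀ᶠ y in 𝓝 p, |a y - p| < δ := by
    have := ha.continuousAt.eventually_mem (Metric.ball_mem_nhds (a p) hδ)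
    simpa [hap, Real.dist_eq] using this
  have hba : ∀ᶠ y in 𝓝[≠] p, |b y - p| < |b (a y) - p| := by
    filter_upwards [hAA, hs.filter_mono nhdsWithin_le_nhds,
      hball.filter_mono nhdsWithin_le_nhds, self_mem_nhdsWithin] with y hy hsy hyδ hyp
    refine H _ _ hyδ ?_
    rcases lt_or_gt_of_ne hyp with h | h
    · have := hsy.2 h
      rw [abs_of_neg (sub_neg.2 this), abs_of_neg (sub_neg.2 h)] at hy
      exact Or.inr ⟨by linarith, h⟩
    · have := hsy.1 h
      rw [abs_of_pos (sub_pos.2 this), abs_of_pos (sub_pos.2 h)] at hy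
      exact Or.inl ⟨h, by linarith⟩
  filter_upwards [hBB, (tendsto_punctured_of_abs_deriv_eq_one hb hbp hbd).eventually hba]
    with x h₁ h₂ using h₁.trans h₂

end LocalDynamics

/-- if two analytic self-maps of an open set `U ⊆ ℝ` share a
non-hyperbolic fixed point `p` and at least one of them preserves orientation at `p`,
then: if `p` is LAS for both maps it is LAS for `f₂ ∘ f₁`, and if `p` is a repeller
for both maps it is a repeller for `f₂ ∘ f₁`. -/
theorem stmt16 (U : Set ℝ) (hUopen : IsOpen U) (f₁ f₂ : ℝ → ℝ)
    (h₁U : Set.MapsTo f₁ U U) (h₂U : Set.MapsTo f₂ U U)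
    (h₁a : AnalyticOnNhd ℝ f₁ U) (h₂a : AnalyticOnNhd ℝ f₂ U)
    (p : ℝ) (hp : p ∈ U) (hfix₁ : f₁ p = p) (hfix₂ : f₂ p = p)
    (hnh₁ : |deriv f₁ p| = 1) (hnh₂ : |deriv f₂ p| = 1)
    (horient : deriv f₁ p = 1 ∨ deriv f₂ p = 1) :
    (IsLAS f₁ p → IsLAS f₂ p → IsLAS (f₂ ∘ f₁) p) ∧
    (IsRepeller f₁ p → IsRepeller f₂ p → IsRepeller (f₂ ∘ f₁) p) := by
  have A₁ := h₁a p hp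
  have A₂ := h₂a p hp
  have t₁ := tendsto_punctured_of_abs_deriv_eq_one A₁ hfix₁ hnh₁
  have t₂ := tendsto_punctured_of_abs_deriv_eq_one A₂ hfix₂ hnh₂
  have hcomp : AnalyticAt ℝ (f₂ ∘ f₁) p := analyticAt_comp_of_fixed A₂ A₁ hfix₁
  have hfix : (f₂ ∘ f₁) p = p := by simp [hfix₁, hfix₂]
  have hcont : ∀ᶠ x in 𝓝 p, ContinuousAt ((f₂ ∘ f₁) ∘ (f₂ ∘ f₁)) x :=
    (analyticAt_comp_of_fixed hcomp hcomp hfix).eventually_continuousAt_nhds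
  refine ⟨fun H₁ H₂ => ?_, fun H₁ H₂ => ?_⟩
  · refine .of_comp_self hcomp.continuousAt hfix
      (isLAS_of_eventually_abs_lt hcont (by simp [hfix₁, hfix₂]) ?_)
    rcases horient with h | h
    · have hsand := H₁.eventually_abs_sandwich_lt A₁ hfix₁ h A₂ hfix₂ hnh₂ H₂
      have hlt := H₁.eventually_abs_lt (preservesSides_of_deriv_eq_one A₁ hfix₁ h)
        A₁.eventually_continuousAt_nhds
      filter_upwards [hlt, t₁.eventually hsand] with x h₁ h₂ using h₂.trans h₁
    · have hsand := H₂.eventually_abs_sandwich_lt A₂ hfix₂ h A₁ hfix₁ hnh₁ H₁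
      have hlt := H₂.eventually_abs_lt (preservesSides_of_deriv_eq_one A₂ hfix₂ h)
        A₂.eventually_continuousAt_nhds
      filter_upwards [hsand, (t₁.comp (t₂.comp t₁)).eventually hlt] with x h₁ h₂
        using h₂.trans h₁
  · refine .of_comp_self (isRepeller_of_eventually_lt_abs hcont ?_)
    rcases horient with h | h
    · have hsand := H₁.eventually_lt_abs_sandwich A₁ hfix₁ h A₂ hfix₂ hnh₂ H₂
      have hlt := H₁.eventually_lt_abs (preservesSides_of_deriv_eq_one A₁ hfix₁ h)
        A₁.eventually_continuousAt_nhds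
      filter_upwards [hlt, t₁.eventually hsand] with x h₁ h₂ using h₁.trans h₂
    · have hsand := H₂.eventually_lt_abs_sandwich A₂ hfix₂ h A₁ hfix₁ hnh₁ H₁
      have hlt := H₂.eventually_lt_abs (preservesSides_of_deriv_eq_one A₂ hfix₂ h)
        A₂.eventually_continuousAt_nhds
      filter_upwards [hsand, (t₁.comp (t₂.comp t₁)).eventually hlt] with x h₁ h₂
        using h₁.trans h₂
end

section
/- Let U ⊆ ℝ be open and let f₁, f₂ : U → U be real-analytic maps with a common fixed point p ∈ U satisfying f₁'(p) = f₂'(p) = −1 (both maps reverse orientation at p), and suppose p is locally asymptotically stable (LAS) for both maps. Then p is either LAS or semi-asymptotically stable (semi-AS) for the composition map f₂ ∘ f₁. -/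
open Filter Topology

/-- A continuous function without fixed points on a preconnected set lies strictly on one side
of the diagonal there. -/
theorem forall_lt_or_forall_gt_of_forall_ne {g : ℝ → ℝ} {s : Set ℝ} (hs : IsPreconnected s)
    (hg : ContinuousOn g s) (hne : ∀ x ∈ s, g x ≠ x) :
    (∀ x ∈ s, g x < x) ∨ (∀ x ∈ s, x < g x) := by
  by_contra! h
  obtain ⟨⟨a, ha, hga⟩, b, hb, hgb⟩ := h
  obtain ⟨c, hc, hgc⟩ := hs.intermediate_value₂ hb ha hg continuousOn_id hgb hga
  exact hne c hc hgc

/-- Near a point, an analytic function is the identity, or lies strictly on one side of the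
diagonal on each side of the point. -/
theorem AnalyticAt.eventually_eq_self_or_eventually_lt_or_gt {g : ℝ → ℝ} {p : ℝ}
    (hg : AnalyticAt ℝ g p) :
    (∀ᶠ x in 𝓝 p, g x = x) ∨
      (((∀ᶠ x in 𝓝[>] p, g x < x) ∨ ∀ᶠ x in 𝓝[>] p, x < g x) ∧
        ((∀ᶠ x in 𝓝[<] p, g x < x) ∨ ∀ᶠ x in 𝓝[<] p, x < g x)) := by
  rcases (hg.sub analyticAt_id).eventually_eq_zero_or_eventually_ne_zero with h | h
  · left
    filter_upwards [h] with x hx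
    simpa [sub_eq_zero] using hx
  · right
    have h' := (eventually_nhdsWithin_iff.1 h).and hg.eventually_continuousAt
    obtain ⟨r, hr, H⟩ := Metric.eventually_nhds_iff_ball.1 h'
    rw [Real.ball_eq_Ioo] at H
    constructor
    · have hmem : Set.Ioo p (p + r) ∈ 𝓝[>] p := Ioo_mem_nhdsGT (by linarith)
      have hsub : ∀ x ∈ Set.Ioo p (p + r), g x ≠ x ∧ ContinuousAt g x := fun x hx => by
        obtain ⟨h1, h2⟩ := H x ⟨by linarith [hx.1], hx.2⟩
        exact ⟨by simpa [sub_eq_zero] using h1 hx.1.ne', h2⟩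
      exact (forall_lt_or_forall_gt_of_forall_ne isPreconnected_Ioo
        (fun x hx => (hsub x hx).2.continuousWithinAt) fun x hx => (hsub x hx).1).imp
        (fun h => mem_of_superset hmem h) fun h => mem_of_superset hmem h
    · have hmem : Set.Ioo (p - r) p ∈ 𝓝[<] p := Ioo_mem_nhdsLT (by linarith)
      have hsub : ∀ x ∈ Set.Ioo (p - r) p, g x ≠ x ∧ ContinuousAt g x := fun x hx => by
        obtain ⟨h1, h2⟩ := H x ⟨hx.1, by linarith [hx.2]⟩
        exact ⟨by simpa [sub_eq_zero] using h1 hx.2.ne, h2⟩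
      exact (forall_lt_or_forall_gt_of_forall_ne isPreconnected_Ioo
        (fun x hx => (hsub x hx).2.continuousWithinAt) fun x hx => (hsub x hx).1).imp
        (fun h => mem_of_superset hmem h) fun h => mem_of_superset hmem h

/-- Iterates of a continuous map lying strictly between `p` and the diagonal on the right of `p`
remain between `p` and the starting point and converge to `p`. -/
theorem exists_forall_iterate_le_and_tendsto_right {g : ℝ → ℝ} {p : ℝ}
    (hg : ∀ᶠ x in 𝓝[>] p, ContinuousAt g x) (hp : ∀ᶠ x in 𝓝[>] p, p < g x)
    (hlt : ∀ᶠ x in 𝓝[>] p, g x < x) :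
    ∃ η > 0, ∀ x ∈ Set.Ioo p (p + η),
      (∀ n : ℕ, p < g^[n] x ∧ g^[n] x ≤ x) ∧ Tendsto (fun n => g^[n] x) atTop (𝓝 p) := by
  obtain ⟨u, hu, H⟩ := mem_nhdsGT_iff_exists_Ioo_subset.1 (hg.and (hp.and hlt))
  refine ⟨u - p, sub_pos.2 hu, fun x hx => ?_⟩
  rw [add_sub_cancel] at hx
  have hb : ∀ n : ℕ, p < g^[n] x ∧ g^[n] x ≤ x := by
    intro n
    induction n with
    | zero => exact ⟨hx.1, le_rfl⟩
    | succ n ih =>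
      obtain ⟨-, h1, h2⟩ := H ⟨ih.1, ih.2.trans_lt hx.2⟩
      rw [Function.iterate_succ_apply']
      exact ⟨h1, h2.le.trans ih.2⟩
  refine ⟨hb, ?_⟩
  have hanti : Antitone fun n => g^[n] x := antitone_nat_of_succ_le fun n => by
    rw [Function.iterate_succ_apply']
    exact (H ⟨(hb n).1, (hb n).2.trans_lt hx.2⟩).2.2.le
  have hlim := tendsto_atTop_ciInf hanti ⟨p, by rintro _ ⟨n, rfl⟩; exact (hb n).1.le⟩
  set l := ⨅ n, g^[n] x
  have hpl : p ≤ l := ge_of_tendsto' hlim fun n => (hb n).1.le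
  have hlx : l ≤ x := le_of_tendsto' hlim fun n => (hb n).2
  rcases hpl.eq_or_lt with h | h
  · rwa [← h] at hlim
  · obtain ⟨h1, -, h2⟩ := H ⟨h, hlx.trans_lt hx.2⟩
    exact absurd (isFixedPt_of_tendsto_iterate hlim h1) h2.ne

/-- A continuous map lying strictly above the diagonal on the right of `p` repels from `p`. -/
theorem exists_forall_exists_lt_abs_iterate_right {g : ℝ → ℝ} {p : ℝ}
    (hg : ∀ᶠ x in 𝓝[>] p, ContinuousAt g x) (hlt : ∀ᶠ x in 𝓝[>] p, x < g x) :
    ∃ η > 0, ∀ x ∈ Set.Ioo p (p + η), ∃ n : ℕ, |g^[n] x - p| > η := by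
  obtain ⟨u, hu, H⟩ := mem_nhdsGT_iff_exists_Ioc_subset.1 (hg.and hlt)
  refine ⟨u - p, sub_pos.2 hu, fun x hx => ?_⟩
  by_contra! hle
  have hub : ∀ n : ℕ, g^[n] x ≤ u := fun n => by linarith [(abs_le.1 (hle n)).2]
  have hb : ∀ n : ℕ, x ≤ g^[n] x := by
    intro n
    induction n with
    | zero => exact le_rfl
    | succ n ih =>
      rw [Function.iterate_succ_apply']
      exact ih.trans (H ⟨hx.1.trans_le ih, hub n⟩).2.le
  have hmono : Monotone fun n => g^[n] x := monotone_nat_of_le_succ fun n => by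
    rw [Function.iterate_succ_apply']
    exact (H ⟨hx.1.trans_le (hb n), hub n⟩).2.le
  have hlim := tendsto_atTop_ciSup hmono ⟨u, by rintro _ ⟨n, rfl⟩; exact hub n⟩
  set l := ⨆ n, g^[n] x
  obtain ⟨h1, h2⟩ := H ⟨hx.1.trans_le (ge_of_tendsto' hlim hb), le_of_tendsto' hlim hub⟩
  exact absurd (isFixedPt_of_tendsto_iterate hlim h1) h2.ne'

theorem iterate_neg_conj (g : ℝ → ℝ) (n : ℕ) (x : ℝ) :
    (fun t => -g (-t))^[n] x = -g^[n] (-x) := by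
  induction n with
  | zero => simp
  | succ n ih => rw [Function.iterate_succ_apply', Function.iterate_succ_apply', ih, neg_neg]

theorem eventually_continuousAt_neg_conj {g : ℝ → ℝ} {p : ℝ}
    (hg : ∀ᶠ x in 𝓝[<] p, ContinuousAt g x) :
    ∀ᶠ x in 𝓝[>] (-p), ContinuousAt (fun t => -g (-t)) x := by
  filter_upwards [tendsto_neg_nhdsGT_neg.eventually hg] with x hx
  exact (ContinuousAt.comp (f := fun t : ℝ => -t) hx continuousAt_neg).neg

/-- Iterates of a continuous map lying strictly between the diagonal and `p` on the left of `p`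
remain between the starting point and `p` and converge to `p`. -/
theorem exists_forall_le_iterate_and_tendsto_left {g : ℝ → ℝ} {p : ℝ}
    (hg : ∀ᶠ x in 𝓝[<] p, ContinuousAt g x) (hp : ∀ᶠ x in 𝓝[<] p, g x < p)
    (hlt : ∀ᶠ x in 𝓝[<] p, x < g x) :
    ∃ η > 0, ∀ x ∈ Set.Ioo (p - η) p,
      (∀ n : ℕ, g^[n] x < p ∧ x ≤ g^[n] x) ∧ Tendsto (fun n => g^[n] x) atTop (𝓝 p) := by
  obtain ⟨η, hη, H⟩ := exists_forall_iterate_le_and_tendsto_right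
    (eventually_continuousAt_neg_conj hg)
    ((tendsto_neg_nhdsGT_neg.eventually hp).mono fun x hx => neg_lt_neg hx)
    ((tendsto_neg_nhdsGT_neg.eventually hlt).mono fun x hx => by linarith)
  refine ⟨η, hη, fun x hx => ?_⟩
  obtain ⟨h1, h2⟩ := H (-x) ⟨by linarith [hx.2], by linarith [hx.1]⟩
  simp only [iterate_neg_conj, neg_neg, neg_lt_neg_iff, neg_le_neg_iff] at h1 h2
  exact ⟨h1, by simpa using h2.neg⟩

/-- A continuous map lying strictly below the diagonal on the left of `p` repels from `p`. -/
theorem exists_forall_exists_lt_abs_iterate_left {g : ℝ → ℝ} {p : ℝ}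
    (hg : ∀ᶠ x in 𝓝[<] p, ContinuousAt g x) (hlt : ∀ᶠ x in 𝓝[<] p, g x < x) :
    ∃ η > 0, ∀ x ∈ Set.Ioo (p - η) p, ∃ n : ℕ, |g^[n] x - p| > η := by
  obtain ⟨η, hη, H⟩ := exists_forall_exists_lt_abs_iterate_right
    (eventually_continuousAt_neg_conj hg)
    ((tendsto_neg_nhdsGT_neg.eventually hlt).mono fun x hx => by linarith)
  refine ⟨η, hη, fun x hx => ?_⟩
  obtain ⟨n, hn⟩ := H (-x) ⟨by linarith [hx.2], by linarith [hx.1]⟩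
  refine ⟨n, ?_⟩
  rwa [iterate_neg_conj, neg_neg, ← neg_sub', abs_neg] at hn

/-- An analytic function with negative derivative at `p` is strictly decreasing near `p`. -/
theorem AnalyticAt.exists_strictAntiOn {f : ℝ → ℝ} {p : ℝ} (hf : AnalyticAt ℝ f p)
    (hd : deriv f p < 0) : ∃ r > 0, StrictAntiOn f (Set.Ioo (p - r) (p + r)) := by
  have h := (hf.deriv.continuousAt.eventually_lt continuousAt_const hd).and
    hf.eventually_continuousAt
  obtain ⟨r, hr, H⟩ := Metric.eventually_nhds_iff_ball.1 h
  rw [Real.ball_eq_Ioo] at H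
  refine ⟨r, hr, strictAntiOn_of_deriv_neg (convex_Ioo _ _)
    (fun x hx => (H x hx).2.continuousWithinAt) fun x hx => (H x ?_).1⟩
  rwa [interior_Ioo] at hx

section StrictAnti

variable {f : ℝ → ℝ} {p r : ℝ}

theorem StrictAntiOn.tendsto_nhdsLT_nhdsGT (hr : 0 < r)
    (hf : StrictAntiOn f (Set.Ioo (p - r) (p + r))) (hc : ContinuousAt f p) (hfix : f p = p) :
    Tendsto f (𝓝[<] p) (𝓝[>] p) := by
  have hc' : Tendsto f (𝓝 p) (𝓝 p) := by simpa [ContinuousAt, hfix] using hc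
  refine tendsto_nhdsWithin_iff.2 ⟨hc'.mono_left nhdsWithin_le_nhds, ?_⟩
  filter_upwards [Ioo_mem_nhdsLT (show p - r < p by linarith)] with x hx
  have := hf ⟨hx.1, by linarith [hx.2]⟩ ⟨by linarith, by linarith⟩ hx.2
  rwa [hfix] at this

theorem StrictAntiOn.tendsto_nhdsGT_nhdsLT (hr : 0 < r)
    (hf : StrictAntiOn f (Set.Ioo (p - r) (p + r))) (hc : ContinuousAt f p) (hfix : f p = p) :
    Tendsto f (𝓝[>] p) (𝓝[<] p) := by
  have hc' : Tendsto f (𝓝 p) (𝓝 p) := by simpa [ContinuousAt, hfix] using hc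
  refine tendsto_nhdsWithin_iff.2 ⟨hc'.mono_left nhdsWithin_le_nhds, ?_⟩
  filter_upwards [Ioo_mem_nhdsGT (show p < p + r by linarith)] with x hx
  have := hf ⟨by linarith, by linarith⟩ ⟨by linarith [hx.1], hx.2⟩ hx.1
  rwa [hfix] at this

/-- The second iterate of a decreasing map with a LAS fixed point lies below the diagonal on the
right of that point. -/
theorem IsLAS.eventually_comp_self_lt (h : IsLAS f p) (hr : 0 < r)
    (hf : StrictAntiOn f (Set.Ioo (p - r) (p + r))) :
    ∀ᶠ x in 𝓝[>] p, f (f x) < x := by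
  obtain ⟨hs, η, hη, ha⟩ := h
  obtain ⟨δ, hδ, hs⟩ := hs r hr
  have hm : 0 < min r (min δ η) := lt_min hr (lt_min hδ hη)
  filter_upwards [Ioo_mem_nhdsGT (show p < p + min r (min δ η) by linarith)] with x hx
  have hxm : |x - p| < min r (min δ η) := abs_lt.2 ⟨by linarith [hx.1], by linarith [hx.2]⟩
  obtain ⟨hxr, hxδ, hxη⟩ : |x - p| < r ∧ |x - p| < δ ∧ |x - p| < η := by
    simpa only [lt_min_iff] using hxm
  have hmem : ∀ n : ℕ, f^[n] x ∈ Set.Ioo (p - r) (p + r) := fun n => by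
    have : |f^[n] x - p| < r := by
      rcases n.eq_zero_or_pos with rfl | hn
      · exact hxr
      · exact hs x hxδ n hn
    rw [abs_lt] at this
    exact ⟨by linarith [this.1], by linarith [this.2]⟩
  by_contra! hle
  have hge : ∀ n : ℕ, x ≤ f^[2 * n] x := by
    intro n
    induction n with
    | zero => exact le_rfl
    | succ n ih =>
      have h1 : f (f^[2 * n] x) ≤ f x := hf.antitoneOn (hmem 0) (hmem _) ih
      rw [← Function.iterate_succ_apply' f] at h1
      have h2 : f (f x) ≤ f (f^[2 * n + 1] x) := hf.antitoneOn (hmem _) (hmem 1) h1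
      rw [← Function.iterate_succ_apply' f] at h2
      exact hle.trans h2
  have hlim : Tendsto (fun n : ℕ => f^[2 * n] x) atTop (𝓝 p) :=
    (ha x hxη).comp (tendsto_id.const_mul_atTop' two_pos)
  exact absurd (ge_of_tendsto' hlim hge) (not_le.2 hx.1)

end StrictAnti

/-- The composition of two decreasing maps with a common LAS fixed point `p` does not lie above the
diagonal on the right of `p` and below it on the left. -/
theorem IsLAS.eventually_lt_comp_or_comp_lt {f₁ f₂ : ℝ → ℝ} {p r₁ r₂ : ℝ}
    (hLAS₁ : IsLAS f₁ p) (hLAS₂ : IsLAS f₂ p) (hr₁ : 0 < r₁) (hr₂ : 0 < r₂)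
    (hf₁ : StrictAntiOn f₁ (Set.Ioo (p - r₁) (p + r₁)))
    (hf₂ : StrictAntiOn f₂ (Set.Ioo (p - r₂) (p + r₂)))
    (hc₁ : ContinuousAt f₁ p) (hc₂ : ContinuousAt f₂ p) (hfix₁ : f₁ p = p) (hfix₂ : f₂ p = p) :
    ∀ᶠ y in 𝓝[<] p, y < f₂ (f₁ y) ∨ f₂ (f₁ (f₁ y)) < f₁ y := by
  have hLR := hf₁.tendsto_nhdsLT_nhdsGT hr₁ hc₁ hfix₁
  have hRL := hf₁.tendsto_nhdsGT_nhdsLT hr₁ hc₁ hfix₁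
  have hRL₂ := hf₂.tendsto_nhdsGT_nhdsLT hr₂ hc₂ hfix₂
  have hI : ∀ r > 0, ∀ᶠ y in 𝓝 p, y ∈ Set.Ioo (p - r) (p + r) := fun r hr =>
    Ioo_mem_nhds (by linarith) (by linarith)
  have hI₁ := nhdsWithin_le_nhds (s := Set.Iio p) (hI r₁ hr₁)
  have hI₂ := nhdsWithin_le_nhds (s := Set.Iio p) (hI r₂ hr₂)
  filter_upwards [hI₁, (hRL.comp hLR).eventually hI₁, (hRL.comp hLR).eventually hI₂,
    (hRL₂.comp hLR).eventually hI₂, hLR.eventually (hLAS₁.eventually_comp_self_lt hr₁ hf₁),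
    hLR.eventually (hLAS₂.eventually_comp_self_lt hr₂ hf₂)] with y hy hy₁ hy₂ hy₃ h₁ h₂
  by_contra! hcon
  have hlt : y < f₁ (f₁ y) := (hf₁.lt_iff_gt hy₁ hy).1 h₁
  have : f₂ (f₁ (f₁ y)) < f₂ (f₂ (f₁ y)) := hf₂ hy₃ hy₂ (hcon.1.trans_lt hlt)
  linarith [hcon.2]

/-- if two analytic self-maps of an open set `U ⊆ ℝ` share a fixed point
`p` with `f₁'(p) = f₂'(p) = -1` which is LAS for both maps, then `p` is either LAS or
semi-AS for the composition `f₂ ∘ f₁`. -/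
theorem stmt17 (U : Set ℝ) (hUopen : IsOpen U) (f₁ f₂ : ℝ → ℝ)
    (h₁U : Set.MapsTo f₁ U U) (h₂U : Set.MapsTo f₂ U U)
    (h₁a : AnalyticOnNhd ℝ f₁ U) (h₂a : AnalyticOnNhd ℝ f₂ U)
    (p : ℝ) (hp : p ∈ U) (hfix₁ : f₁ p = p) (hfix₂ : f₂ p = p)
    (hd₁ : deriv f₁ p = -1) (hd₂ : deriv f₂ p = -1)
    (hLAS₁ : IsLAS f₁ p) (hLAS₂ : IsLAS f₂ p) :
    IsLAS (f₂ ∘ f₁) p ∨ IsSemiAS (f₂ ∘ f₁) p := by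
  have ha₁ := h₁a p hp
  have ha₂ := h₂a p hp
  obtain ⟨r₁, hr₁, hf₁⟩ := ha₁.exists_strictAntiOn (by rw [hd₁]; norm_num)
  obtain ⟨r₂, hr₂, hf₂⟩ := ha₂.exists_strictAntiOn (by rw [hd₂]; norm_num)
  have hLR := hf₁.tendsto_nhdsLT_nhdsGT hr₁ ha₁.continuousAt hfix₁
  have hRL := hf₁.tendsto_nhdsGT_nhdsLT hr₁ ha₁.continuousAt hfix₁
  have hLR₂ := hf₂.tendsto_nhdsLT_nhdsGT hr₂ ha₂.continuousAt hfix₂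
  have hRL₂ := hf₂.tendsto_nhdsGT_nhdsLT hr₂ ha₂.continuousAt hfix₂
  have hgR : ∀ᶠ x in 𝓝[>] p, p < (f₂ ∘ f₁) x := (hLR₂.comp hRL).eventually self_mem_nhdsWithin
  have hgL : ∀ᶠ x in 𝓝[<] p, (f₂ ∘ f₁) x < p := (hRL₂.comp hLR).eventually self_mem_nhdsWithin
  have hkey := hLAS₁.eventually_lt_comp_or_comp_lt hLAS₂ hr₁ hr₂ hf₁ hf₂ ha₁.continuousAt
    ha₂.continuousAt hfix₁ hfix₂
  have hg : AnalyticAt ℝ (f₂ ∘ f₁) p := AnalyticAt.comp (by rwa [hfix₁]) ha₁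
  have hgp : (f₂ ∘ f₁) p = p := by simp [hfix₁, hfix₂]
  have hcR := nhdsWithin_le_nhds (s := Set.Ioi p) hg.eventually_continuousAt
  have hcL := nhdsWithin_le_nhds (s := Set.Iio p) hg.eventually_continuousAt
  rcases hg.eventually_eq_self_or_eventually_lt_or_gt with hid | ⟨hR | hR, hL | hL⟩
  · have hid' : ∀ᶠ x in 𝓝[<] p, (f₂ ∘ f₁) x = x := nhdsWithin_le_nhds (s := Set.Iio p) hid
    have hid₁ := hLR.eventually (nhdsWithin_le_nhds hid)
    obtain ⟨y, h, h1, h2⟩ := (hkey.and (hid'.and hid₁)).exists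
    exact absurd h (not_or.2 ⟨h1.not_gt, h2.not_lt⟩)
  · obtain ⟨η, hη, H⟩ := exists_forall_iterate_le_and_tendsto_right hcR hgR hR
    refine Or.inr (Or.inr ⟨fun ε hε => ⟨min ε η, lt_min hε hη, fun x hx n _ => ?_⟩,
      ⟨η, hη, fun x hx => (H x hx).2⟩, exists_forall_exists_lt_abs_iterate_left hcL hL⟩)
    obtain ⟨h1, h2⟩ := (H x ⟨hx.1, by linarith [hx.2, min_le_right ε η]⟩).1 n
    exact abs_lt.2 ⟨by linarith, by linarith [hx.2, min_le_left ε η]⟩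
  · obtain ⟨η, hη, H⟩ := exists_forall_iterate_le_and_tendsto_right hcR hgR hR
    obtain ⟨η', hη', H'⟩ := exists_forall_le_iterate_and_tendsto_left hcL hgL hL
    have hall : ∀ x, |x - p| < min η η' → (∀ n : ℕ, |(f₂ ∘ f₁)^[n] x - p| ≤ |x - p|) ∧
        Tendsto (fun n => (f₂ ∘ f₁)^[n] x) atTop (𝓝 p) := by
      intro x hx
      obtain ⟨h1, h2⟩ := lt_min_iff.1 hx
      rcases lt_trichotomy x p with h | rfl | h
      · obtain ⟨h3, h4⟩ := H' x ⟨by linarith [(abs_lt.1 h2).1], h⟩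
        refine ⟨fun n => ?_, h4⟩
        rw [abs_of_neg (sub_neg.2 h), abs_of_neg (sub_neg.2 (h3 n).1)]
        linarith [(h3 n).2]
      · simp only [Function.iterate_fixed hgp]
        exact ⟨fun _ => le_rfl, tendsto_const_nhds⟩
      · obtain ⟨h3, h4⟩ := H x ⟨h, by linarith [(abs_lt.1 h1).2]⟩
        refine ⟨fun n => ?_, h4⟩
        rw [abs_of_pos (sub_pos.2 h), abs_of_pos (sub_pos.2 (h3 n).1)]
        linarith [(h3 n).2]
    refine Or.inl ⟨fun ε hε => ⟨min ε (min η η'), lt_min hε (lt_min hη hη'), fun x hx n _ => ?_⟩,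
      min η η', lt_min hη hη', fun x hx => (hall x hx).2⟩
    exact ((hall x (hx.trans_le (min_le_right _ _))).1 n).trans_lt (hx.trans_le (min_le_left _ _))
  · obtain ⟨y, h, h1, h2⟩ := (hkey.and (hL.and (hLR.eventually hR))).exists
    exact absurd h (not_or.2 ⟨h1.not_gt, h2.not_gt⟩)
  · obtain ⟨η, hη, H⟩ := exists_forall_le_iterate_and_tendsto_left hcL hgL hL
    refine Or.inr (Or.inl ⟨fun ε hε => ⟨min ε η, lt_min hε hη, fun x hx n _ => ?_⟩,
      ⟨η, hη, fun x hx => (H x hx).2⟩, exists_forall_exists_lt_abs_iterate_right hcR hR⟩)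
    obtain ⟨h1, h2⟩ := (H x ⟨by linarith [hx.1, min_le_right ε η], hx.2⟩).1 n
    exact abs_lt.2 ⟨by linarith [hx.1, min_le_left ε η], by linarith⟩
end

section
/- Consider the polynomial maps g₁(x) = −x + 2x² − 4x³ + 31x⁵, g₂(x) = −x + 5x² − 25x³ + 1241x⁵ and g₃(x) = −x + 3x² − 9x³ + 160x⁵ on ℝ. The origin is a repeller fixed point for each of g₁, g₂, g₃; the origin is locally asymptotically stable (LAS) for the composition g₃ ∘ g₂ ∘ g₁; and the origin is a repeller for the composition in the reversed order g₁ ∘ g₂ ∘ g₃. -/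
open Filter Topology

/-- `f` agrees with `c₁ x + c₂ x² + c₃ x³ + c₄ x⁴ + c₅ x⁵` up to a continuous multiple of `x⁶`. -/
def HasJet (f : ℝ → ℝ) (c₁ c₂ c₃ c₄ c₅ : ℝ) : Prop :=
  ∃ R : ℝ → ℝ, Continuous R ∧
    ∀ x, f x = c₁ * x + c₂ * x ^ 2 + c₃ * x ^ 3 + c₄ * x ^ 4 + c₅ * x ^ 5 + x ^ 6 * R x

namespace HasJet

variable {f g : ℝ → ℝ} {a₁ a₂ a₃ a₄ a₅ b₁ b₂ b₃ b₄ b₅ : ℝ}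

lemma id : HasJet (fun x => x) 1 0 0 0 0 :=
  ⟨fun _ => 0, continuous_const, fun x => by ring⟩

lemma add (hf : HasJet f a₁ a₂ a₃ a₄ a₅) (hg : HasJet g b₁ b₂ b₃ b₄ b₅) :
    HasJet (fun x => f x + g x) (a₁ + b₁) (a₂ + b₂) (a₃ + b₃) (a₄ + b₄) (a₅ + b₅) := by
  obtain ⟨R, hR, hf⟩ := hf
  obtain ⟨S, hS, hg⟩ := hg
  exact ⟨fun x => R x + S x, by fun_prop, fun x => by beta_reduce; rw [hf, hg]; ring⟩

lemma const_mul (k : ℝ) (hf : HasJet f a₁ a₂ a₃ a₄ a₅) :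
    HasJet (fun x => k * f x) (k * a₁) (k * a₂) (k * a₃) (k * a₄) (k * a₅) := by
  obtain ⟨R, hR, hf⟩ := hf
  exact ⟨fun x => k * R x, by fun_prop, fun x => by beta_reduce; rw [hf]; ring⟩

lemma mul (hf : HasJet f a₁ a₂ a₃ a₄ a₅) (hg : HasJet g b₁ b₂ b₃ b₄ b₅) :
    HasJet (fun x => f x * g x) 0 (a₁ * b₁) (a₁ * b₂ + a₂ * b₁)
      (a₁ * b₃ + a₂ * b₂ + a₃ * b₁) (a₁ * b₄ + a₂ * b₃ + a₃ * b₂ + a₄ * b₁) := by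
  obtain ⟨R, hR, hf⟩ := hf
  obtain ⟨S, hS, hg⟩ := hg
  refine ⟨fun x => (a₁ * b₅ + a₂ * b₄ + a₃ * b₃ + a₄ * b₂ + a₅ * b₁)
    + (a₂ * b₅ + a₃ * b₄ + a₄ * b₃ + a₅ * b₂) * x + (a₃ * b₅ + a₄ * b₄ + a₅ * b₃) * x ^ 2
    + (a₄ * b₅ + a₅ * b₄) * x ^ 3 + a₅ * b₅ * x ^ 4
    + (a₁ * x + a₂ * x ^ 2 + a₃ * x ^ 3 + a₄ * x ^ 4 + a₅ * x ^ 5) * S x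
    + R x * (b₁ * x + b₂ * x ^ 2 + b₃ * x ^ 3 + b₄ * x ^ 4 + b₅ * x ^ 5)
    + x ^ 6 * R x * S x, by fun_prop, fun x => ?_⟩
  beta_reduce
  rw [hf, hg]
  ring

/-- Post-composition with a quintic `-y + p y² + q y³ + s y⁵`. -/
lemma quintic (p q s : ℝ) (hf : HasJet f a₁ a₂ a₃ a₄ a₅) :
    HasJet (fun x => -f x + p * f x ^ 2 + q * f x ^ 3 + s * f x ^ 5)
      (-a₁) (-a₂ + p * a₁ ^ 2) (-a₃ + p * (2 * a₁ * a₂) + q * a₁ ^ 3)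
      (-a₄ + p * (2 * a₁ * a₃ + a₂ ^ 2) + q * (3 * a₁ ^ 2 * a₂))
      (-a₅ + p * (2 * a₁ * a₄ + 2 * a₂ * a₃) + q * (3 * a₁ ^ 2 * a₃ + 3 * a₁ * a₂ ^ 2)
        + s * a₁ ^ 5) := by
  have h₂ := hf.mul hf
  have h₃ := h₂.mul hf
  have h := ((hf.const_mul (-1)).add (h₂.const_mul p)).add (h₃.const_mul q) |>.add
    ((h₃.mul h₂).const_mul s)
  convert h using 1
  · funext x; ring
  all_goals ring

/-- A jet `x + c x⁵` is `x (1 + x⁴ u)` with `u` close to `c`. -/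
lemma exists_factor {c : ℝ} (hf : HasJet f 1 0 0 0 c) :
    ∃ u : ℝ → ℝ, Continuous u ∧ u 0 = c ∧ ∀ x, f x = x * (1 + x ^ 4 * u x) := by
  obtain ⟨R, hR, hf⟩ := hf
  exact ⟨fun x => c + x * R x, by fun_prop, by simp, fun x => by rw [hf]; ring⟩

lemma exists_lt_abs_apply {c : ℝ} (hc : 0 < c) (hf : HasJet f 1 0 0 0 c) :
    ∃ r > 0, ∀ x, x ≠ 0 → |x| < r → |x| < |f x| := by
  obtain ⟨u, hu, hu₀, hf⟩ := hf.exists_factor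
  have h : ∀ᶠ x in 𝓝 0, 0 < u x :=
    hu.continuousAt.eventually (lt_mem_nhds (by rwa [hu₀]))
  obtain ⟨r, hr, h⟩ := Metric.eventually_nhds_iff.1 h
  refine ⟨r, hr, fun x hx hxr => ?_⟩
  have hux : 0 < u x := h (by simpa using hxr)
  have hpos : 0 < x ^ 4 * u x := by positivity
  rw [hf, abs_mul, abs_of_pos (by linarith : 0 < 1 + x ^ 4 * u x)]
  exact lt_mul_of_one_lt_right (abs_pos.2 hx) (by linarith)

lemma exists_abs_apply_lt {c : ℝ} (hc : c < 0) (hf : HasJet f 1 0 0 0 c) :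
    ∃ r > 0, ∀ x, x ≠ 0 → |x| < r → |f x| < |x| := by
  obtain ⟨u, hu, hu₀, hf⟩ := hf.exists_factor
  have h : ∀ᶠ x in 𝓝 0, u x < 0 :=
    hu.continuousAt.eventually (gt_mem_nhds (by rwa [hu₀]))
  have hv : Continuous fun x => x ^ 4 * u x := by fun_prop
  have h' : ∀ᶠ x in 𝓝 0, -1 < x ^ 4 * u x :=
    hv.continuousAt.eventually (lt_mem_nhds (by norm_num))
  obtain ⟨r, hr, h⟩ := Metric.eventually_nhds_iff.1 (h.and h')
  refine ⟨r, hr, fun x hx hxr => ?_⟩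
  obtain ⟨hux, hx'⟩ := h (by simpa using hxr : dist x 0 < r)
  have hneg : x ^ 4 * u x < 0 := mul_neg_of_pos_of_neg (by positivity) hux
  rw [hf, abs_mul, abs_of_pos (by linarith : 0 < 1 + x ^ 4 * u x)]
  exact mul_lt_of_lt_one_right (abs_pos.2 hx) (by linarith)

end HasJet

/-- A continuous map that strictly increases the absolute value near `0` moves every nonzero
orbit out of any small interval. -/
lemma exists_abs_iterate_gt {F : ℝ → ℝ} (hF : Continuous F) {ε : ℝ}
    (h : ∀ x, x ≠ 0 → |x| ≤ ε → |x| < |F x|) {x : ℝ} (hx : x ≠ 0) : ∃ n, ε < |F^[n] x| := by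
  by_contra! hb
  let K := Metric.closedBall (0 : ℝ) ε ∩ {y | |x| ≤ |y|}
  have hK : IsCompact K :=
    (isCompact_closedBall 0 ε).inter_right (isClosed_le continuous_const continuous_abs)
  have hxK : x ∈ K := ⟨by simpa using hb 0, le_refl |x|⟩
  obtain ⟨y, ⟨hyε, hyx⟩, hmin⟩ := hK.exists_isMinOn ⟨x, hxK⟩
    (f := fun y => |F y| - |y|) (by fun_prop)
  have hy : y ≠ 0 := abs_pos.1 ((abs_pos.2 hx).trans_le hyx)
  have hc : 0 < |F y| - |y| := sub_pos.2 (h y hy (by simpa using hyε))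
  have key : ∀ n : ℕ, |x| + n * (|F y| - |y|) ≤ |F^[n] x| := by
    intro n
    induction n with
    | zero => simp
    | succ n ih =>
      have hn : F^[n] x ∈ K :=
        ⟨by simpa using hb n, (le_add_of_nonneg_right (by positivity)).trans ih⟩
      have hstep : |F y| - |y| ≤ |F (F^[n] x)| - |F^[n] x| := hmin hn
      rw [Function.iterate_succ_apply']
      push_cast
      linarith
  obtain ⟨n, hn⟩ := exists_nat_gt (ε / (|F y| - |y|))
  rw [div_lt_iff₀ hc] at hn
  linarith [key n, hb n, abs_nonneg x]

lemma abs_iterate_le {F : ℝ → ℝ} {r : ℝ} (h : ∀ x, |x| < r → |F x| ≤ |x|) {x : ℝ}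
    (hx : |x| < r) (n : ℕ) : |F^[n] x| ≤ |x| := by
  induction n with
  | zero => simp
  | succ n ih =>
    rw [Function.iterate_succ_apply']
    exact (h _ (ih.trans_lt hx)).trans ih

/-- A continuous map that strictly decreases the absolute value near `0` attracts orbits to `0`. -/
lemma tendsto_iterate_zero {F : ℝ → ℝ} (hF : Continuous F) {r : ℝ}
    (hle : ∀ x, |x| < r → |F x| ≤ |x|) (h : ∀ x, x ≠ 0 → |x| < r → |F x| < |x|) {x : ℝ}
    (hx : |x| < r) : Tendsto (fun n => F^[n] x) atTop (𝓝 0) := by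
  rw [Metric.tendsto_atTop]
  intro ε hε
  suffices hN : ∃ N, |F^[N] x| < ε by
    obtain ⟨N, hN⟩ := hN
    refine ⟨N, fun n hn => ?_⟩
    obtain ⟨m, rfl⟩ := Nat.exists_eq_add_of_le' hn
    have hNr : |F^[N] x| < r := (abs_iterate_le hle hx N).trans_lt hx
    rw [Real.dist_0_eq_abs, Function.iterate_add_apply]
    exact (abs_iterate_le hle hNr m).trans_lt hN
  by_contra! hb
  let K := Metric.closedBall (0 : ℝ) |x| ∩ {y | ε ≤ |y|}
  have hK : IsCompact K :=
    (isCompact_closedBall 0 |x|).inter_right (isClosed_le continuous_const continuous_abs)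
  have hxK : x ∈ K := ⟨by simp, hb 0⟩
  obtain ⟨y, ⟨hyx, hyε⟩, hmin⟩ := hK.exists_isMinOn ⟨x, hxK⟩
    (f := fun y => |y| - |F y|) (by fun_prop)
  have hc : 0 < |y| - |F y| := sub_pos.2
    (h y (abs_pos.1 (hε.trans_le hyε)) (lt_of_le_of_lt (by simpa using hyx) hx))
  have key : ∀ n : ℕ, |F^[n] x| + n * (|y| - |F y|) ≤ |x| := by
    intro n
    induction n with
    | zero => simp
    | succ n ih =>
      have hn : F^[n] x ∈ K := ⟨by simpa using abs_iterate_le hle hx n, hb n⟩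
      have hstep : |y| - |F y| ≤ |F^[n] x| - |F (F^[n] x)| := hmin hn
      rw [Function.iterate_succ_apply']
      push_cast
      linarith
  obtain ⟨n, hn⟩ := exists_nat_gt (|x| / (|y| - |F y|))
  rw [div_lt_iff₀ hc] at hn
  linarith [key n, abs_nonneg (F^[n] x)]

lemma isRepeller_of_hasJet {f : ℝ → ℝ} (hf : Continuous f) {c : ℝ} (hc : 0 < c)
    (h : HasJet (f ∘ f) 1 0 0 0 c) : IsRepeller f 0 := by
  obtain ⟨r, hr, h⟩ := h.exists_lt_abs_apply hc
  refine ⟨r, hr, fun ε _ hεr x hx _ => ?_⟩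
  obtain ⟨n, hn⟩ := exists_abs_iterate_gt (hf.comp hf)
    (fun y hy hyε => h y hy (hyε.trans_lt hεr)) hx
  refine ⟨2 * n, ?_⟩
  rw [sub_zero, Function.iterate_mul]
  exact hn

lemma isLAS_of_hasJet {f : ℝ → ℝ} (hf : Continuous f) (hf₀ : f 0 = 0) {c : ℝ} (hc : c < 0)
    (h : HasJet (f ∘ f) 1 0 0 0 c) : IsLAS f 0 := by
  obtain ⟨r, hr, h⟩ := h.exists_abs_apply_lt hc
  have hle : ∀ x, |x| < r → |(f ∘ f) x| ≤ |x| := by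
    intro x hx
    rcases eq_or_ne x 0 with rfl | hx₀
    · simp [hf₀]
    · exact (h x hx₀ hx).le
  have heven : ∀ (n : ℕ) (x : ℝ), f^[2 * n] x = (f ∘ f)^[n] x := fun n x => by
    rw [Function.iterate_mul]; rfl
  have hodd : ∀ (n : ℕ) (x : ℝ), f^[2 * n + 1] x = f ((f ∘ f)^[n] x) := fun n x => by
    rw [Function.iterate_succ_apply', heven]
  have hcont : ∀ ε > 0, ∃ δ > 0, ∀ x, |x| < δ → |f x| < ε := by
    simpa [hf₀, Real.dist_eq] using Metric.continuousAt_iff.1 (hf.continuousAt (x := 0))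
  refine ⟨fun ε hε => ?_, r, hr, fun x hx => ?_⟩
  · obtain ⟨δ, hδ, hfδ⟩ := hcont ε hε
    refine ⟨min δ (min ε r), by positivity, fun x hx n _ => ?_⟩
    simp only [sub_zero, lt_min_iff] at hx ⊢
    obtain ⟨hxδ, hxε, hxr⟩ := hx
    obtain ⟨k, rfl | rfl⟩ := n.even_or_odd'
    · rw [heven]
      exact (abs_iterate_le hle hxr k).trans_lt hxε
    · rw [hodd]
      exact hfδ _ ((abs_iterate_le hle hxr k).trans_lt hxδ)
  · rw [sub_zero] at hx
    have ht := Metric.tendsto_atTop.1 (tendsto_iterate_zero (hf.comp hf) hle h hx)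
    rw [Metric.tendsto_atTop]
    intro ε hε
    obtain ⟨δ, hδ, hfδ⟩ := hcont ε hε
    obtain ⟨N, hN⟩ := ht (min δ ε) (by positivity)
    refine ⟨2 * N, fun n hn => ?_⟩
    obtain ⟨k, hk⟩ := n.even_or_odd'
    have hkN := hN k (by omega)
    rw [Real.dist_0_eq_abs, lt_min_iff] at hkN
    rw [Real.dist_0_eq_abs]
    rcases hk with rfl | rfl
    · rw [heven]
      exact hkN.2
    · rw [hodd]
      exact hfδ _ hkN.1

/-- for `g₁(x) = -x + 2x² - 4x³ + 31x⁵`, `g₂(x) = -x + 5x² - 25x³ + 1241x⁵`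
and `g₃(x) = -x + 3x² - 9x³ + 160x⁵`, the origin is a repeller for each `gᵢ`, LAS for
`g₃ ∘ g₂ ∘ g₁`, and a repeller for `g₁ ∘ g₂ ∘ g₃`. -/
theorem stmt18
    (g₁ g₂ g₃ : ℝ → ℝ)
    (hg₁ : g₁ = fun x => -x + 2 * x ^ 2 - 4 * x ^ 3 + 31 * x ^ 5)
    (hg₂ : g₂ = fun x => -x + 5 * x ^ 2 - 25 * x ^ 3 + 1241 * x ^ 5)
    (hg₃ : g₃ = fun x => -x + 3 * x ^ 2 - 9 * x ^ 3 + 160 * x ^ 5) :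
    IsRepeller g₁ 0 ∧ IsRepeller g₂ 0 ∧ IsRepeller g₃ 0 ∧
    IsLAS (g₃ ∘ g₂ ∘ g₁) 0 ∧ IsRepeller (g₁ ∘ g₂ ∘ g₃) 0 := by
  have j₁ {f : ℝ → ℝ} {a₁ a₂ a₃ a₄ a₅ : ℝ} (h : HasJet f a₁ a₂ a₃ a₄ a₅) :=
    h.quintic 2 (-4) 31
  have j₂ {f : ℝ → ℝ} {a₁ a₂ a₃ a₄ a₅ : ℝ} (h : HasJet f a₁ a₂ a₃ a₄ a₅) :=
    h.quintic 5 (-25) 1241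
  have j₃ {f : ℝ → ℝ} {a₁ a₂ a₃ a₄ a₅ : ℝ} (h : HasJet f a₁ a₂ a₃ a₄ a₅) :=
    h.quintic 3 (-9) 160
  have c₁ : Continuous g₁ := by rw [hg₁]; fun_prop
  have c₂ : Continuous g₂ := by rw [hg₂]; fun_prop
  have c₃ : Continuous g₃ := by rw [hg₃]; fun_prop
  refine ⟨isRepeller_of_hasJet c₁ (c := 2) (by norm_num) ?_,
    isRepeller_of_hasJet c₂ (c := 18) (by norm_num) ?_,
    isRepeller_of_hasJet c₃ (c := 4) (by norm_num) ?_,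
    isLAS_of_hasJet (c₃.comp (c₂.comp c₁)) (by simp [hg₁, hg₂, hg₃]) (c := -96)
      (by norm_num) ?_,
    isRepeller_of_hasJet (c₁.comp (c₂.comp c₃)) (c := 144) (by norm_num) ?_⟩
  · convert j₁ (j₁ HasJet.id) using 1
    · funext x; simp only [hg₁, Function.comp_apply, neg_mul, ← sub_eq_add_neg]
    all_goals norm_num
  · convert j₂ (j₂ HasJet.id) using 1
    · funext x; simp only [hg₂, Function.comp_apply, neg_mul, ← sub_eq_add_neg]
    all_goals norm_num
  · convert j₃ (j₃ HasJet.id) using 1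
    · funext x; simp only [hg₃, Function.comp_apply, neg_mul, ← sub_eq_add_neg]
    all_goals norm_num
  · convert j₃ (j₂ (j₁ (j₃ (j₂ (j₁ HasJet.id))))) using 1
    · funext x; simp only [hg₁, hg₂, hg₃, Function.comp_apply, neg_mul, ← sub_eq_add_neg]
    all_goals norm_num
  · convert j₁ (j₂ (j₃ (j₁ (j₂ (j₃ HasJet.id))))) using 1
    · funext x; simp only [hg₁, hg₂, hg₃, Function.comp_apply, neg_mul, ← sub_eq_add_neg]
    all_goals norm_num
end

section
/- There exists a sequence of real-analytic maps f_n : ℝ → ℝ, n ≥ 1, each having the origin as a globally asymptotically stable (GAS) fixed point on ℝ, such that the non-autonomous system x_{n+1} = f_{n+1}(x_n) with initial condition x₀ = 1 has an unbounded solution; in fact one can take maps for which the solution is y_n = (−1)ⁿ(n+1). -/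
open Filter Topology

/-- `p` is a globally asymptotically stable (GAS) fixed point of `f` on `ℝ`. -/
def IsGAS (f : ℝ → ℝ) (p : ℝ) : Prop :=
  IsLAS f p ∧ ∀ x : ℝ, Tendsto (fun n => f^[n] x) atTop (𝓝 p)

lemma iterate_mem_Icc {f : ℝ → ℝ} (hnn : ∀ x, 0 ≤ f x) (hle : ∀ x, 0 ≤ x → f x ≤ x)
    {y : ℝ} (hy : 0 ≤ y) (n : ℕ) : f^[n] y ∈ Set.Icc 0 y := by
  induction n with
  | zero => exact ⟨hy, le_rfl⟩
  | succ n ih =>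
    rw [Function.iterate_succ_apply']
    exact ⟨hnn _, (hle _ ih.1).trans ih.2⟩

/-- A continuous nonnegative map lying below the identity on the positive half-line, with fixed
point `0`, is globally asymptotically stable there. -/
lemma isGAS_of_nonneg_of_lt {f : ℝ → ℝ} (hf : Continuous f) (h0 : f 0 = 0)
    (hnn : ∀ x, 0 ≤ f x) (hlt : ∀ x, 0 < x → f x < x) : IsGAS f 0 := by
  have hle : ∀ x, 0 ≤ x → f x ≤ x := fun x hx => by
    rcases hx.eq_or_lt with rfl | hx
    · exact h0.le
    · exact (hlt x hx).le
  have hconv_nonneg : ∀ y, 0 ≤ y → Tendsto (fun n => f^[n] y) atTop (𝓝 0) := fun y hy => by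
    have hmem := iterate_mem_Icc hnn hle hy
    have hanti : Antitone fun n => f^[n] y := antitone_nat_of_succ_le fun n => by
      rw [Function.iterate_succ_apply']
      exact hle _ (hmem n).1
    have hlim := tendsto_atTop_ciInf hanti ⟨0, by rintro _ ⟨n, rfl⟩; exact (hmem n).1⟩
    have hfix := isFixedPt_of_tendsto_iterate hlim hf.continuousAt
    have hl : 0 ≤ ⨅ n, f^[n] y := le_ciInf fun n => (hmem n).1
    rcases hl.eq_or_lt with hl | hl
    · rwa [← hl] at hlim
    · exact absurd hfix (hlt _ hl).ne
  have hconv : ∀ x, Tendsto (fun n => f^[n] x) atTop (𝓝 0) := fun x =>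
    (tendsto_add_atTop_iff_nat 1).1 (hconv_nonneg (f x) (hnn x))
  refine ⟨⟨fun ε hε => ?_, 1, one_pos, fun x _ => hconv x⟩, hconv⟩
  obtain ⟨δ, hδ, hfδ⟩ := Metric.continuousAt_iff.1 (hf.continuousAt (x := 0)) ε hε
  refine ⟨δ, hδ, fun x hx n hn => ?_⟩
  obtain ⟨m, rfl⟩ := Nat.exists_eq_add_of_le' hn
  have hmem := iterate_mem_Icc hnn hle (hnn x) m
  have hfx : |f x| < ε := by simpa [Real.dist_eq, h0] using hfδ (by simpa [Real.dist_eq] using hx)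
  rw [Function.iterate_succ_apply, sub_zero, abs_of_nonneg hmem.1]
  exact hmem.2.trans_lt ((le_abs_self _).trans_lt hfx)

/-- Global asymptotic stability of the origin is invariant under conjugation by `x ↦ -x`. -/
lemma IsGAS.neg_conj {f : ℝ → ℝ} (h : IsGAS f 0) : IsGAS (fun x => -f (-x)) 0 := by
  have hit : ∀ (n : ℕ) (x : ℝ), (fun x => -f (-x))^[n] x = -f^[n] (-x) := fun n x => by
    have hs : Function.Semiconj (fun x : ℝ => -x) f (fun x => -f (-x)) := fun x => by simp
    simpa using ((hs.iterate_right n) (-x)).symm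
  have hconv : ∀ x, Tendsto (fun n => (fun x => -f (-x))^[n] x) atTop (𝓝 0) := fun x => by
    simpa [hit] using (h.2 (-x)).neg
  refine ⟨⟨fun ε hε => ?_, 1, one_pos, fun x _ => hconv x⟩, hconv⟩
  obtain ⟨δ, hδ, hst⟩ := h.1.1 ε hε
  refine ⟨δ, hδ, fun x hx n hn => ?_⟩
  simpa [hit] using hst (-x) (by simpa using hx) n hn

lemma isGAS_mul_sq_mul_exp_neg {c : ℝ} (hc : 0 ≤ c) (hc1 : c ≤ 1) :
    IsGAS (fun x => c * x ^ 2 * Real.exp (-x)) 0 := by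
  refine isGAS_of_nonneg_of_lt (by fun_prop) (by simp) (fun x => by positivity) fun x hx => ?_
  have hexp : x * Real.exp (-x) < 1 := by
    rw [Real.exp_neg, ← div_eq_mul_inv, div_lt_one (Real.exp_pos x)]
    linarith [Real.add_one_le_exp x]
  calc c * x ^ 2 * Real.exp (-x) = c * (x * (x * Real.exp (-x))) := by ring
    _ ≤ 1 * (x * (x * Real.exp (-x))) := by gcongr
    _ < x := by nlinarith

lemma isGAS_signed_mul_sq_mul_exp {c s : ℝ} (hc : 0 ≤ c) (hc1 : c ≤ 1) (hs : s = 1 ∨ s = -1) :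
    IsGAS (fun x => s * (c * x ^ 2 * Real.exp (-(s * x)))) 0 := by
  rcases hs with rfl | rfl
  · simpa using isGAS_mul_sq_mul_exp_neg hc hc1
  · simpa using (isGAS_mul_sq_mul_exp_neg hc hc1).neg_conj

/-- there is a sequence of real-analytic maps `fₙ : ℝ → ℝ`, `n ≥ 1`,
each with the origin as a GAS fixed point, such that the solution of the
non-autonomous system `x_{n+1} = f_{n+1}(xₙ)` with `x₀ = 1` is the unbounded sequence
`xₙ = (-1)ⁿ (n+1)`. -/
theorem stmt19 :
    ∃ f : ℕ → ℝ → ℝ,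
      (∀ n, 1 ≤ n → AnalyticOnNhd ℝ (f n) Set.univ ∧ IsGAS (f n) 0) ∧
      ∀ x : ℕ → ℝ, x 0 = 1 → (∀ n, x (n + 1) = f (n + 1) (x n)) →
        (∀ n, x n = (-1) ^ n * (n + 1)) ∧ ¬ ∃ M : ℝ, ∀ n, |x n| ≤ M := by
  refine ⟨fun n x => (-1) ^ n * ((n + 1) / (n ^ 2 * Real.exp n) * x ^ 2 *
    Real.exp (-((-1) ^ n * x))), fun n hn => ⟨?_, ?_⟩, fun x hx0 hx => ?_⟩
  · intro x _
    fun_prop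
  · have hn' : (1 : ℝ) ≤ n := by exact_mod_cast hn
    refine isGAS_signed_mul_sq_mul_exp (by positivity) ?_ (neg_one_pow_eq_or ℝ n)
    rw [div_le_one (by positivity)]
    calc (n : ℝ) + 1 ≤ Real.exp n := Real.add_one_le_exp _
      _ ≤ n ^ 2 * Real.exp n := le_mul_of_one_le_left (Real.exp_pos _).le (one_le_pow₀ hn')
  · have hsol : ∀ n, x n = (-1) ^ n * (n + 1) := fun n => by
      induction n with
      | zero => simpa using hx0
      | succ n ih =>
        have hsq : ((-1 : ℝ) ^ n) ^ 2 = 1 := by rw [← pow_mul, mul_comm, pow_mul]; simp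
        have harg : -((-1 : ℝ) ^ (n + 1) * ((-1) ^ n * (n + 1))) = ((n + 1 : ℕ) : ℝ) := by
          push_cast
          linear_combination (n + 1 : ℝ) * hsq
        rw [hx, ih]
        beta_reduce
        rw [harg, mul_pow, hsq]
        have hn : ((n + 1 : ℕ) : ℝ) ≠ 0 := by positivity
        have he := (Real.exp_pos ((n + 1 : ℕ) : ℝ)).ne'
        push_cast at hn he ⊢
        field_simp
    refine ⟨hsol, fun ⟨M, hM⟩ => ?_⟩
    obtain ⟨n, hn⟩ := exists_nat_gt M
    have hMn := hM n
    rw [hsol, abs_mul, abs_neg_one_pow, one_mul, abs_of_nonneg (by positivity)] at hMn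
    linarith
end
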